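/- Let c₁, c₂ ∈ ℂ and Q(w) = (w² + c₁)² + c₂. If every critical point w of Q (i.e. every w with Q′(w) = 0) has unbounded orbit (Q^{∘n}(w)), then the alternated filled Julia set K_{P_{c₁c₂}} is totally disconnected as a topological subspace of ℂ. -/

import Mathlib

/-- The alternated orbit of `z₀` with parameters `c₁, c₂`:
`z_{n+1} = zₙ² + c₁` if `n` is even, `z_{n+1} = zₙ² + c₂` if `n` is odd. -/
def altOrbit (c₁ c₂ z₀ : ℂ) : ℕ → ℂ
  | 0 => z₀
  | n + 1 => if Even n then (altOrbit c₁ c₂ z₀ n) ^ 2 + c₁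
             else (altOrbit c₁ c₂ z₀ n) ^ 2 + c₂

/-- The alternated filled Julia set `K_{P_{c₁ c₂}}`. -/
def altK (c₁ c₂ : ℂ) : Set ℂ :=
  {z₀ | Bornology.IsBounded (Set.range (altOrbit c₁ c₂ z₀))}

/-- Existence of a holomorphic square root of `z - p` on `V`. -/
def HasRoot (V : Set ℂ) (p : ℂ) : Prop :=
  ∃ s : ℂ → ℂ, DifferentiableOn ℂ s V ∧ ∀ z ∈ V, s z ^ 2 = z - p

lemma cpow_half_sq (w : ℂ) : (w ^ ((1 : ℂ) / 2)) ^ 2 = w := by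
  simp

lemma slit_of_lt {w : ℂ} (h : ‖w - 1‖ < 1) : w ∈ Complex.slitPlane := by
  left
  have := Complex.abs_re_le_norm (w - 1)
  simp only [Complex.sub_re, Complex.one_re] at this
  have := (abs_le.1 this).1
  linarith

lemma HasRoot.far {V : Set ℂ} {R : ℝ} (hV : ∀ z ∈ V, ‖z‖ ≤ R) {p : ℂ} (hp : R < ‖p‖) :
    HasRoot V p := by
  by_cases hR : R < 0
  · refine ⟨id, differentiableOn_id, fun z hz => ?_⟩
    have := hV z hz
    have := norm_nonneg z
    linarith
  push Not at hR
  have hp0 : p ≠ 0 := norm_pos_iff.1 (by linarith)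
  refine ⟨fun z => (-p) ^ ((1 : ℂ) / 2) * (1 - z / p) ^ ((1 : ℂ) / 2), ?_, ?_⟩
  · intro z hz
    apply DifferentiableAt.differentiableWithinAt
    apply DifferentiableAt.const_mul
    apply DifferentiableAt.cpow (by fun_prop) (by fun_prop)
    apply slit_of_lt
    have h1 : (1 - z / p - 1) = - (z / p) := by ring
    rw [h1, norm_neg, norm_div, div_lt_one (by linarith)]
    linarith [hV z hz]
  · intro z hz
    simp only [mul_pow, cpow_half_sq]
    field_simp
    ring

lemma HasRoot.near {V : Set ℂ} {p p' : ℂ} {d : ℝ} (h : HasRoot V p')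
    (hd : ∀ z ∈ V, d ≤ ‖z - p'‖) (hpp : ‖p - p'‖ < d) : HasRoot V p := by
  obtain ⟨s, hs, hs2⟩ := h
  have hd0 : 0 < d := lt_of_le_of_lt (norm_nonneg _) hpp
  have hne : ∀ z ∈ V, z - p' ≠ 0 := fun z hz => norm_pos_iff.1 (lt_of_lt_of_le hd0 (hd z hz))
  refine ⟨fun z => s z * ((z - p) / (z - p')) ^ ((1 : ℂ) / 2), ?_, ?_⟩
  · apply hs.mul
    intro z hz
    apply DifferentiableAt.differentiableWithinAt
    have h0 := hne z hz
    have hdd : DifferentiableAt ℂ (fun z : ℂ => (z - p) / (z - p')) z := by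
      fun_prop (disch := exact h0)
    apply DifferentiableAt.cpow hdd (by fun_prop)
    apply slit_of_lt
    have h1 : (z - p) / (z - p') - 1 = (p' - p) / (z - p') := by
      field_simp
      ring
    rw [h1, norm_div, div_lt_one (norm_pos_iff.2 h0), norm_sub_rev]
    linarith [hd z hz]
  · intro z hz
    have h0 := hne z hz
    simp only [mul_pow, cpow_half_sq, hs2 z hz]
    field_simp

lemma hasRoot_of_poly {V : Set ℂ} {R C : ℝ} (hV : ∀ z ∈ V, ‖z‖ ≤ R) {P : ℂ → ℂ}
    (hP : Differentiable ℂ P) (hPV : ∀ z ∈ V, ‖P z‖ ≤ C) {p : ℂ} (hp : C < ‖P p‖) :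
    HasRoot V p := by
  by_contra hcon
  have hcl : ∀ z ∈ closure V, ‖P z‖ ≤ C := by
    have : IsClosed {z | ‖P z‖ ≤ C} := isClosed_le hP.continuous.norm continuous_const
    exact fun z hz => closure_minimal hPV this hz
  -- the bad set
  set B : Set ℂ := {q | q ∉ closure V ∧ ¬ HasRoot V q} with hB
  have hpB : p ∈ B := ⟨fun h => by linarith [hcl p h], hcon⟩
  have hdist : ∀ q, q ∉ closure V → ∃ d > 0, ∀ q', ‖q' - q‖ < d → 
      ∀ z ∈ V, d ≤ ‖z - q'‖ := by
    intro q hq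
    obtain ⟨e, he, hball⟩ := Metric.isOpen_iff.1 isClosed_closure.isOpen_compl q hq
    refine ⟨e / 2, by linarith, fun q' hq' z hz => ?_⟩
    by_contra hlt
    push Not at hlt
    refine (hball (a := z) ?_) (subset_closure hz)
    rw [Metric.mem_ball, dist_eq_norm]
    have : z - q = (z - q') + (q' - q) := by ring
    rw [this]
    linarith [norm_add_le (z - q') (q' - q)]
  have hBbdd : Bornology.IsBounded B := by
    refine (Metric.isBounded_closedBall (x := (0 : ℂ)) (r := R)).subset ?_
    intro q hq
    rw [mem_closedBall_zero_iff]
    by_contra hlt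
    push Not at hlt
    exact hq.2 (HasRoot.far hV hlt)
  have hfr : ∀ z ∈ frontier B, ‖P z‖ ≤ C := by
    intro z hz
    apply hcl
    by_contra hzV
    obtain ⟨d, hd, hdV⟩ := hdist z hzV
    have hzz := hdV z (by simpa using hd)
    rw [frontier_eq_closure_inter_closure] at hz
    obtain ⟨q1, hq1, hq1d⟩ := Metric.mem_closure_iff.1 hz.1 d hd
    rw [dist_eq_norm] at hq1d
    have hzn : ¬ HasRoot V z := by
      intro hzr
      exact hq1.2 (hzr.near hzz (by rwa [norm_sub_rev]))
    -- then a neighbourhood of z lies in B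
    have hop : IsOpen (closure V)ᶜ := isClosed_closure.isOpen_compl
    obtain ⟨e, he, hball⟩ := Metric.isOpen_iff.1 hop z hzV
    obtain ⟨q2, hq2, hq2d⟩ := Metric.mem_closure_iff.1 hz.2 (min d e) (lt_min hd he)
    rw [dist_eq_norm] at hq2d
    apply hq2
    refine ⟨hball ?_, fun hr => hzn (hr.near (hdV q2 ?_) (lt_of_lt_of_le hq2d (min_le_left _ _)))⟩
    · rw [Metric.mem_ball, dist_eq_norm, norm_sub_rev]
      exact lt_of_lt_of_le hq2d (min_le_right _ _)
    · rw [norm_sub_rev]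
      exact lt_of_lt_of_le hq2d (min_le_left _ _)
  have := Complex.norm_le_of_forall_mem_frontier_norm_le hBbdd hP.diffContOnCl hfr
    (subset_closure hpB)
  linarith

/-- The quartic. -/
def quart (c₁ c₂ : ℂ) : ℂ → ℂ := fun w => (w ^ 2 + c₁) ^ 2 + c₂

lemma quart_diff (c₁ c₂ : ℂ) : Differentiable ℂ (quart c₁ c₂) := by
  unfold quart; fun_prop

lemma altOrbit_even (c₁ c₂ z : ℂ) (n : ℕ) :
    altOrbit c₁ c₂ z (2 * n) = (quart c₁ c₂)^[n] z := by
  induction n with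
  | zero => rfl
  | succ k ih =>
    rw [Function.iterate_succ_apply', ← ih]
    have h1 : ¬ Even (2 * k + 1) := by simp
    have h2 : Even (2 * k) := by simp
    show altOrbit c₁ c₂ z (2 * k + 1 + 1) = _
    rw [altOrbit, if_neg h1, altOrbit, if_pos h2]
    rfl

lemma sq_escape {R : ℝ} {c z : ℂ} (hR : 2 + ‖c‖ ≤ R) (hz : R ≤ ‖z‖) :
    2 * ‖z‖ ≤ ‖z ^ 2 + c‖ := by
  have h1 : ‖z ^ 2‖ ≤ ‖z ^ 2 + c‖ + ‖c‖ := by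
    have := norm_sub_le (z ^ 2 + c) c
    simpa using this
  rw [norm_pow] at h1
  have := norm_nonneg c
  nlinarith

/-- The inductive contraction step. -/
lemma branch_exists {Q : ℂ → ℂ} {V V1 K : Set ℂ} {R t ρ : ℝ} (ht : 0 < t) (hρ : 0 < ρ)
    (hVo : IsOpen V) (hVR : ∀ z ∈ V, ‖z‖ ≤ R) (hV1V : V1 ⊆ V)
    (hQc : Continuous Q)
    (hstar : ∀ a ∈ V1, ∀ b ∈ V1, a + (t : ℂ) * (a - b) ∈ V)
    (hQK : Set.MapsTo Q K K)
    (hsel : ∀ E ⊆ K, IsPreconnected E → ∃ g : ℂ → ℂ, DifferentiableOn ℂ g V ∧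
      Set.MapsTo g V V1 ∧ ∀ z ∈ E, g (Q z) = z)
    (n : ℕ) : ∀ E ⊆ K, IsPreconnected E → ∃ G : ℂ → ℂ, DifferentiableOn ℂ G V ∧
      Set.MapsTo G V V ∧ (∀ z ∈ E, G (Q^[n] z) = z) ∧
      ∀ F : ℂ → ℂ, DifferentiableOn ℂ F V → (∀ z ∈ V, ‖F z‖ ≤ R) →
        ∀ x, Metric.closedBall x ρ ⊆ V → (1 + t) ^ n * ‖deriv (fun z => F (G z)) x‖ ≤ R / ρ := by
  induction n with
  | zero =>
    intro E _ _
    refine ⟨id, differentiableOn_id, Set.mapsTo_id V, fun z _ => rfl, fun F hF hFR x hx => ?_⟩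
    simp only [pow_zero, one_mul, id]
    apply Complex.norm_deriv_le_of_forall_mem_sphere_norm_le hρ
    · apply DifferentiableOn.diffContOnCl
      rw [closure_ball _ hρ.ne']
      exact hF.mono hx
    · exact fun z hz => hFR z (hx (Metric.sphere_subset_closedBall hz))
  | succ n ih =>
    intro E hEK hE
    obtain ⟨g, hg, hgm, hgE⟩ := hsel E hEK hE
    obtain ⟨G, hG, hGm, hGE, hGF⟩ := ih (Q '' E) 
      (by rintro _ ⟨z, hz, rfl⟩; exact hQK (hEK hz)) (hE.image _ hQc.continuousOn)
    refine ⟨fun z => g (G z), hg.comp hG hGm, fun z hz => hV1V (hgm (hGm hz)), ?_, ?_⟩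
    · intro z hz
      show g (G (Q^[n] (Q z))) = z
      rw [hGE (Q z) ⟨z, hz, rfl⟩, hgE z hz]
    · intro F hF hFR x hx
      have hxV : x ∈ V := hx (Metric.mem_closedBall_self hρ.le)
      have hyV := hGm hxV
      set y := G x with hy
      have hmaps : Set.MapsTo (fun z => g z + (t : ℂ) * (g z - g y)) V V :=
        fun z hz => hstar _ (hgm hz) _ (hgm hyV)
      have hd : DifferentiableOn ℂ (fun z => g z + (t : ℂ) * (g z - g y)) V :=
        hg.add ((hg.sub_const _).const_mul _)
      have key := hGF (fun z => F (g z + (t : ℂ) * (g z - g y))) (hF.comp hd hmaps)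
        (fun z hz => hFR _ (hmaps hz)) x hx
      have hG' := (hG.differentiableAt (hVo.mem_nhds hxV)).hasDerivAt
      have hg' := (hg.differentiableAt (hVo.mem_nhds hyV)).hasDerivAt
      have hF' := (hF.differentiableAt (hVo.mem_nhds (hV1V (hgm hyV)))).hasDerivAt
      have e1 : HasDerivAt (fun z => F (g (G z))) (deriv F (g y) * (deriv g y * deriv G x)) x :=
        HasDerivAt.comp x (h₂ := F) (h := fun z => g (G z)) hF'
          (HasDerivAt.comp x (h₂ := g) (h := G) hg' hG')
      have e2 : HasDerivAt (fun z => F (g (G z) + (t : ℂ) * (g (G z) - g y)))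
          (deriv F (g y) * ((deriv g y * deriv G x) + t * (deriv g y * deriv G x))) x := by
        have hgG := HasDerivAt.comp x (h₂ := g) (h := G) hg' hG'
        have h3 : HasDerivAt (fun z => g (G z) + (t : ℂ) * (g (G z) - g y)) _ x :=
          hgG.add ((hgG.sub_const (g y)).const_mul (t : ℂ))
        refine HasDerivAt.comp x (h₂ := F)
          (h := fun z => g (G z) + (t : ℂ) * (g (G z) - g y)) ?_ h3
        simpa [← hy] using hF'
      rw [e2.deriv] at key
      rw [e1.deriv]
      have e3 : deriv F (g y) * ((deriv g y * deriv G x) + t * (deriv g y * deriv G x))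
        = ((1 + t : ℝ) : ℂ) * (deriv F (g y) * (deriv g y * deriv G x)) := by push_cast; ring
      rw [e3, norm_mul, Complex.norm_real, Real.norm_of_nonneg (by linarith)] at key
      rw [pow_succ]
      linarith

/-- A preconnected set covered by few small balls is small. -/
lemma dist_le_of_cover {E : Set ℂ} (hE : IsPreconnected E) {x y : ℂ} (hx : x ∈ E) (hy : y ∈ E)
    (T : Finset ℂ) (c : ℂ → ℂ) {η : ℝ}
    (hcov : ∀ z ∈ E, ∃ j ∈ T, dist z (c j) ≤ η) : dist y x ≤ T.card * (2 * η) := by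
  have hη : 0 ≤ η := by
    obtain ⟨j, _, hj⟩ := hcov x hx
    exact dist_nonneg.trans hj
  have him : IsPreconnected ((fun z => dist z x) '' E) :=
    hE.image _ (by fun_prop)
  have hIcc : Set.Icc 0 (dist y x) ⊆ (fun z => dist z x) '' E :=
    him.Icc_subset ⟨x, hx, dist_self x⟩ ⟨y, hy, rfl⟩
  have hsub : Set.Icc 0 (dist y x) ⊆ ⋃ j ∈ T, Metric.closedBall (dist (c j) x) η := by
    intro u hu
    obtain ⟨z, hz, rfl⟩ := hIcc hu
    obtain ⟨j, hjT, hj⟩ := hcov z hz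
    simp only [Set.mem_iUnion]
    refine ⟨j, hjT, ?_⟩
    rw [Metric.mem_closedBall, Real.dist_eq]
    exact (abs_dist_sub_le z (c j) x).trans hj
  have hm := (MeasureTheory.measure_mono (μ := MeasureTheory.volume) hsub).trans
    (MeasureTheory.measure_biUnion_finset_le T _)
  simp only [Real.volume_Icc, Real.volume_closedBall, Finset.sum_const, sub_zero,
    nsmul_eq_mul] at hm
  rw [← ENNReal.ofReal_natCast, ← ENNReal.ofReal_mul (by positivity)] at hm
  exact (ENNReal.ofReal_le_ofReal_iff (by positivity)).1 hm

theorem stmt_16 (c₁ c₂ : ℂ)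
    (h : ∀ w : ℂ, deriv (fun w : ℂ => (w ^ 2 + c₁) ^ 2 + c₂) w = 0 →
      ¬ Bornology.IsBounded
        (Set.range fun n : ℕ => (fun w : ℂ => (w ^ 2 + c₁) ^ 2 + c₂)^[n] w)) :
    IsTotallyDisconnected (altK c₁ c₂) := by
  change ∀ w : ℂ, deriv (fun w : ℂ => (w ^ 2 + c₁) ^ 2 + c₂) w = 0 →
      ¬ Bornology.IsBounded (Set.range fun n : ℕ => (quart c₁ c₂)^[n] w) at h
  have hder : ∀ w : ℂ, (w ^ 2 + c₁) * w = 0 →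
      deriv (fun w : ℂ => (w ^ 2 + c₁) ^ 2 + c₂) w = 0 := by
    intro w hw
    have h1 : HasDerivAt (fun w : ℂ => (w ^ 2 + c₁) ^ 2 + c₂)
        (2 * (w ^ 2 + c₁) * (2 * w)) w := by
      have := ((((hasDerivAt_id w).pow 2).add_const c₁).pow 2).add_const c₂
      simpa using this
    rw [h1.deriv]
    linear_combination 4 * hw
  set Q := quart c₁ c₂ with hQ
  have hQd : Differentiable ℂ Q := quart_diff c₁ c₂
  have hQc : Continuous Q := hQd.continuous
  have hQnd : ∀ n, Differentiable ℂ (Q^[n]) := fun n => hQd.iterate n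
  set R : ℝ := 2 + ‖c₁‖ + ‖c₂‖ with hR
  have hc1 := norm_nonneg c₁
  have hc2 := norm_nonneg c₂
  have hesc : ∀ z, R ≤ ‖z‖ → 2 * ‖z‖ ≤ ‖Q z‖ := by
    intro z hz
    have h1 := sq_escape (c := c₁) (by linarith) hz
    have h2 := sq_escape (c := c₂) (z := z ^ 2 + c₁) (R := R) (by linarith) (by linarith)
    have : Q z = (z ^ 2 + c₁) ^ 2 + c₂ := rfl
    rw [this]
    linarith
  have hescn : ∀ n z, R ≤ ‖z‖ → 2 ^ n * ‖z‖ ≤ ‖Q^[n] z‖ := by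
    intro n
    induction n with
    | zero => intro z _; simp
    | succ n ih =>
      intro z hz
      rw [Function.iterate_succ_apply]
      have h1 := hesc z hz
      have h2 := ih (Q z) (by linarith)
      have : (2 : ℝ) ^ n * (2 * ‖z‖) ≤ 2 ^ n * ‖Q z‖ := by gcongr
      rw [pow_succ]
      linarith
  have hescn' : ∀ n z, R ≤ ‖z‖ → ‖z‖ ≤ ‖Q^[n] z‖ := by
    intro n z hz
    refine le_trans ?_ (hescn n z hz)
    exact le_mul_of_one_le_left (norm_nonneg z) (one_le_pow₀ (by norm_num))
  -- critical orbits eventually escape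
  have hcrit : ∀ w : ℂ, (w ^ 2 + c₁) * w = 0 → ∃ n, ∀ m ≥ n, R < ‖Q^[m] w‖ := by
    intro w hw
    by_contra hcon
    push Not at hcon
    apply h w (hder w hw)
    refine (Metric.isBounded_closedBall (x := (0 : ℂ)) (r := R)).subset ?_
    rintro _ ⟨n, rfl⟩
    rw [mem_closedBall_zero_iff]
    by_contra hlt
    push Not at hlt
    obtain ⟨m, hm, hmR⟩ := hcon n
    obtain ⟨k, rfl⟩ := Nat.exists_eq_add_of_le' hm
    rw [Function.iterate_add_apply] at hmR
    have := hescn' k _ hlt.le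
    linarith
  obtain ⟨a, ha⟩ := IsAlgClosed.exists_pow_nat_eq (-c₁) (n := 2) (by norm_num)
  obtain ⟨n1, hn1⟩ := hcrit a (by rw [ha]; ring)
  obtain ⟨n2, hn2⟩ := hcrit 0 (by ring)
  set N := n1 + n2 with hN
  have hN1 : R < ‖Q^[N] c₂‖ := by
    have := hn1 (N + 1) (by omega)
    rw [Function.iterate_succ_apply] at this
    have h2 : Q a = c₂ := by simp [hQ, quart, ha]
    rwa [h2] at this
  have hN2 : R < ‖Q^[N] (c₁ ^ 2 + c₂)‖ := by
    have := hn2 (N + 1) (by omega)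
    rw [Function.iterate_succ_apply] at this
    have h2 : Q 0 = c₁ ^ 2 + c₂ := by simp [hQ, quart]
    rwa [h2] at this
  set V : Set ℂ := {z | ‖Q^[N] z‖ < R} with hV
  set U : Set ℂ := {u | u ^ 2 + c₂ ∈ V} with hU
  set V1 : Set ℂ := {z | Q z ∈ V} with hV1
  have hVo : IsOpen V := isOpen_lt (hQnd N).continuous.norm continuous_const
  have hVR : ∀ z ∈ V, ‖z‖ ≤ R := by
    intro z hz
    by_contra hlt
    push Not at hlt
    have h1 := hescn' N z hlt.le
    have h2 : ‖Q^[N] z‖ < R := hz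
    linarith
  have hUR : ∀ u ∈ U, ‖u‖ ≤ R := by
    intro u hu
    by_contra hlt
    push Not at hlt
    have h1 := sq_escape (c := c₂) (R := R) (by linarith) hlt.le
    have h2 := hVR _ hu
    linarith
  have hstrict : ∀ z, ‖Q^[N] (Q z)‖ ≤ R → z ∈ V := by
    intro z hz
    show ‖Q^[N] z‖ < R
    by_contra hlt
    push Not at hlt
    rw [← Function.iterate_succ_apply, Function.iterate_succ_apply'] at hz
    have := hesc _ hlt
    linarith
  have hV1V : V1 ⊆ V := fun z hz => hstrict z (le_of_lt hz)
  have hclV1 : closure V1 ⊆ V := by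
    have hc : IsClosed {z | ‖Q^[N] (Q z)‖ ≤ R} :=
      isClosed_le ((hQnd N).continuous.comp hQc).norm continuous_const
    have hsub : V1 ⊆ {z | ‖Q^[N] (Q z)‖ ≤ R} := by
      intro w hw
      have hw' : ‖Q^[N] (Q w)‖ < R := hw
      exact hw'.le
    exact fun z hz => hstrict z (closure_minimal hsub hc hz)
  have hV1b : Bornology.IsBounded V1 := by
    refine (Metric.isBounded_closedBall (x := (0 : ℂ)) (r := R)).subset fun z hz => ?_
    rw [mem_closedBall_zero_iff]
    exact hVR z (hV1V hz)
  obtain ⟨ε, hε, hεV⟩ := hV1b.isCompact_closure.exists_thickening_subset_open hVo hclV1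
  have hball : ∀ a ∈ V1, Metric.ball a ε ⊆ V := fun a ha z hz =>
    hεV (Metric.mem_thickening_iff.2 ⟨a, subset_closure ha, hz⟩)
  -- the two square roots
  obtain ⟨s, hs, hs2⟩ : HasRoot V c₂ :=
    hasRoot_of_poly hVR (hQnd N) (fun z hz => le_of_lt hz) hN1
  obtain ⟨r, hr, hr2⟩ : HasRoot U c₁ :=
    hasRoot_of_poly (P := fun u => Q^[N] (u ^ 2 + c₂)) hUR
      ((hQnd N).comp (by fun_prop)) (fun z hz => le_of_lt hz) hN2
  have hs0 : ∀ z ∈ V, s z ≠ 0 := by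
    intro z hz h0
    have h1 := hs2 z hz
    rw [h0] at h1
    have h2 : z = c₂ := by linear_combination -h1
    rw [h2] at hz
    exact absurd hN1 (not_lt.2 (le_of_lt hz))
  have hr0 : ∀ z ∈ U, r z ≠ 0 := by
    intro z hz h0
    have h1 := hr2 z hz
    rw [h0] at h1
    have h2 : z = c₁ := by linear_combination -h1
    rw [h2] at hz
    exact absurd hN2 (not_lt.2 (le_of_lt hz))
  set K : Set ℂ := {z | Bornology.IsBounded (Set.range fun n => Q^[n] z)} with hK
  have hKR : ∀ z ∈ K, ∀ n, ‖Q^[n] z‖ < R := by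
    intro z hz n
    by_contra hlt
    push Not at hlt
    have hz' : Bornology.IsBounded (Set.range fun n => Q^[n] z) := hz
    obtain ⟨C, hC⟩ := hz'.exists_norm_le
    obtain ⟨m, hm⟩ := pow_unbounded_of_one_lt C (one_lt_two (α := ℝ))
    have h1 := hescn m _ hlt
    have h2 := hC _ ⟨m + n, rfl⟩
    simp only [Function.iterate_add_apply] at h2
    have h3 : (2 : ℝ) ^ m * 1 ≤ 2 ^ m * ‖Q^[n] z‖ := by gcongr; linarith
    linarith
  have hQK : Set.MapsTo Q K K := by
    intro z hz
    have hz' : Bornology.IsBounded (Set.range fun n => Q^[n] z) := hz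
    refine hz'.subset ?_
    rintro _ ⟨n, rfl⟩
    exact ⟨n + 1, rfl⟩
  have hKV : K ⊆ V := fun z hz => hKR z hz N
  have hKV1 : K ⊆ V1 := fun z hz => hKV (hQK hz)
  have hsel : ∀ E ⊆ K, IsPreconnected E → ∃ g : ℂ → ℂ, DifferentiableOn ℂ g V ∧
      Set.MapsTo g V V1 ∧ ∀ z ∈ E, g (Q z) = z := by
    intro E hEK hE
    have hQE : Set.MapsTo Q E V := fun z hz => hKV1 (hEK hz)
    have huU : Set.MapsTo (fun z => z ^ 2 + c₁) E U := fun z hz => hQE hz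
    have hS : ∃ σ : ℂ → ℂ, DifferentiableOn ℂ σ V ∧ (∀ z ∈ V, σ z ^ 2 = z - c₂) ∧
        ∀ z ∈ E, z ^ 2 + c₁ = σ (Q z) := by
      rcases hE.eq_or_eq_neg_of_sq_eq (f := fun z => z ^ 2 + c₁) (g := fun z => s (Q z))
        (by fun_prop) (hs.continuousOn.comp hQc.continuousOn hQE)
        (fun z hz => by
          simp only [Pi.pow_apply]
          rw [hs2 _ (hQE hz)]
          simp [hQ, quart])
        (fun {z} hz => hs0 _ (hQE hz)) with h1 | h1
      · exact ⟨s, hs, hs2, fun z hz => h1 hz⟩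
      · exact ⟨fun z => - s z, hs.neg, fun z hz => by rw [neg_sq, hs2 z hz], fun z hz => h1 hz⟩
    have hT : ∃ τ : ℂ → ℂ, DifferentiableOn ℂ τ U ∧ (∀ z ∈ U, τ z ^ 2 = z - c₁) ∧
        ∀ z ∈ E, z = τ (z ^ 2 + c₁) := by
      rcases hE.eq_or_eq_neg_of_sq_eq (f := fun z => z) (g := fun z => r (z ^ 2 + c₁))
        (by fun_prop) (hr.continuousOn.comp (by fun_prop) huU)
        (fun z hz => by
          simp only [Pi.pow_apply]
          rw [hr2 _ (huU hz)]
          simp)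
        (fun {z} hz => hr0 _ (huU hz)) with h1 | h1
      · exact ⟨r, hr, hr2, fun z hz => h1 hz⟩
      · exact ⟨fun z => - r z, hr.neg, fun z hz => by rw [neg_sq, hr2 z hz], fun z hz => h1 hz⟩
    obtain ⟨σ, hσ, hσ2, hσE⟩ := hS
    obtain ⟨τ, hτ, hτ2, hτE⟩ := hT
    have hσU : Set.MapsTo σ V U := by
      intro z hz
      show σ z ^ 2 + c₂ ∈ V
      rw [hσ2 z hz]
      simpa using hz
    refine ⟨fun z => τ (σ z), hτ.comp hσ hσU, ?_, ?_⟩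
    · intro z hz
      show ((τ (σ z)) ^ 2 + c₁) ^ 2 + c₂ ∈ V
      rw [hτ2 _ (hσU hz), sub_add_cancel, hσ2 z hz, sub_add_cancel]
      exact hz
    · intro z hz
      show τ (σ (Q z)) = z
      rw [← hσE z hz, ← hτE z hz]
  have hRpos : 0 < R := by linarith
  set t : ℝ := ε / (4 * R) with ht
  have htpos : 0 < t := by positivity
  have hstar : ∀ a ∈ V1, ∀ b ∈ V1, a + (t : ℂ) * (a - b) ∈ V := by
    intro a ha b hb
    apply hball a ha
    rw [Metric.mem_ball, dist_eq_norm, add_sub_cancel_left, norm_mul, Complex.norm_real,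
      Real.norm_of_nonneg htpos.le]
    have h1 : ‖a - b‖ ≤ 2 * R := by
      linarith [norm_sub_le a b, hVR a (hV1V ha), hVR b (hV1V hb)]
    calc t * ‖a - b‖ ≤ t * (2 * R) := by gcongr
      _ = ε / 2 := by rw [ht]; field_simp; norm_num
      _ < ε := by linarith
  have hρ : 0 < ε / 3 := by positivity
  obtain ⟨T, hTV, hTfin, hTcov⟩ := Metric.finite_approx_of_totallyBounded
    (hV1b.isCompact_closure.totallyBounded.subset subset_closure) (ε / 2) (by positivity)
  -- main argument
  intro E hE hEp x hx y hy
  have hEK : E ⊆ K := by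
    intro z hz
    have hz' : Bornology.IsBounded (Set.range (altOrbit c₁ c₂ z)) := hE hz
    refine hz'.subset ?_
    rintro _ ⟨n, rfl⟩
    exact ⟨2 * n, altOrbit_even c₁ c₂ z n⟩
  have hmain : ∀ n : ℕ, dist y x ≤
      hTfin.toFinset.card * (2 * ((R / (ε / 3) * (1 + t)⁻¹ ^ n) * (ε / 2))) := by
    intro n
    obtain ⟨G, hG, hGm, hGE, hGF⟩ := branch_exists htpos hρ hVo hVR hV1V hQc hstar hQK hsel n
      E hEK hEp
    refine dist_le_of_cover hEp hx hy _ G ?_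
    intro z hz
    have hzn : Q^[n] z ∈ V1 := hKV1 ((hQK.iterate n) (hEK hz))
    obtain ⟨j, hj, hjz⟩ := Set.mem_iUnion₂.1 (hTcov hzn)
    refine ⟨j, by simpa using hj, ?_⟩
    have hjV := hball j (hTV hj)
    have hbV : Metric.ball j (ε / 2) ⊆ V := (Metric.ball_subset_ball (by linarith)).trans hjV
    rw [← hGE z hz, dist_eq_norm]
    have hlip := (convex_ball j (ε / 2)).norm_image_sub_le_of_norm_deriv_le (𝕜 := ℂ) (f := G)
      (C := R / (ε / 3) * (1 + t)⁻¹ ^ n) (x := j) (y := Q^[n] z)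
      (fun w hw => hG.differentiableAt (hVo.mem_nhds (hbV hw)))
      (fun w hw => by
        have h1 := hGF id differentiableOn_id hVR w
          (by
            intro v hv
            apply hjV
            rw [Metric.mem_ball] at hw ⊢
            rw [Metric.mem_closedBall] at hv
            linarith [dist_triangle v w j])
        simp only [id] at h1
        rw [inv_pow, ← div_eq_mul_inv, le_div_iff₀ (by positivity)]
        calc _ = (1 + t) ^ n * ‖deriv G w‖ := by ring
          _ ≤ _ := h1)
      (Metric.mem_ball_self (by positivity)) hjz
    refine hlip.trans ?_
    rw [Metric.mem_ball, dist_eq_norm] at hjz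
    gcongr
  have hlim : Filter.Tendsto (fun n : ℕ =>
      (hTfin.toFinset.card : ℝ) * (2 * ((R / (ε / 3) * (1 + t)⁻¹ ^ n) * (ε / 2))))
      Filter.atTop (nhds ((hTfin.toFinset.card : ℝ) * (2 * ((R / (ε / 3) * 0) * (ε / 2))))) := by
    have := tendsto_pow_atTop_nhds_zero_of_lt_one (r := (1 + t)⁻¹) (by positivity)
      (inv_lt_one_of_one_lt₀ (by linarith))
    exact ((((this.const_mul _).mul_const _).const_mul _).const_mul _)
  have h0 := ge_of_tendsto' hlim hmain
  simp only [mul_zero, zero_mul] at h0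
  exact (dist_le_zero.1 h0).symm
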